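/- arXiv:2309.17181 — 2 statements merged into one kernel-verified Lean document; each statement's English description precedes it below -/
import Mathlib

section
/- Under the genericity assumptions, det(U_R · D_R · L_R) = ∏_{r=0}^{n} b₂^{−(n−r)} c^{−r(n−r)} · (x b₁;c)_r / (x b₂^{−1} c^{−(r−1)};c)_r. (Corollary 1.3.9: the determinant of the R-matrix R_{2,1}(x₂/x₁), realized through the Gauss decomposition of Theorem 1.3.3, equals ∏_{r=0}^n q^{−(n−r)(β₂+rγ)} ((x₂/x₁)q^{β₁};q^γ)_r / ((x₂/x₁)q^{−β₂−(r−1)γ};q^γ)_r; this formula was conjectured by Mimachi.) -/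
open Finset

/-- The q-Pochhammer symbol `(x;c)_m = ∏_{i=0}^{m-1} (1 - c^i x)`. -/
noncomputable def qPoch (x c : ℂ) (m : ℕ) : ℂ := ∏ i ∈ Finset.range m, (1 - c ^ i * x)

/-- The upper triangular factor `U_R` of Theorem 1.3.3. -/
noncomputable def URmat (n : ℕ) (c x b₁ b₂ : ℂ) : Matrix (Fin (n + 1)) (Fin (n + 1)) ℂ :=
  fun r s =>
    if (r : ℕ) ≤ (s : ℕ) then
      (-1 : ℂ) ^ ((s : ℕ) - (r : ℕ)) * (x * b₂⁻¹) ^ ((s : ℕ) - (r : ℕ)) *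
        c ^ (-((((s : ℕ) - (r : ℕ)) * ((s : ℕ) + (r : ℕ) - 1) / 2 : ℕ) : ℤ)) *
        (qPoch c c (s : ℕ) / (qPoch c c ((s : ℕ) - (r : ℕ)) * qPoch c c (r : ℕ))) *
        (qPoch (b₁ * c ^ (n - (s : ℕ))) c ((s : ℕ) - (r : ℕ)) /
          qPoch (x * b₁ * b₂⁻¹ * c ^ ((n : ℤ) - 2 * (s : ℤ) + 1)) c ((s : ℕ) - (r : ℕ)))
    else 0

/-- The diagonal entries `d_{R,r}` of the factor `D_R` of Theorem 1.3.3. -/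
noncomputable def dRdiag (n : ℕ) (c x b₁ b₂ : ℂ) (r : Fin (n + 1)) : ℂ :=
  (b₂ ^ (n - (r : ℕ)))⁻¹ * (c ^ ((r : ℕ) * (n - (r : ℕ))))⁻¹ *
    (qPoch (x * b₁) c (n - (r : ℕ)) /
      qPoch (x * b₂⁻¹ * c ^ ((1 : ℤ) - (r : ℤ))) c (r : ℕ)) *
    (qPoch (x * b₁ * b₂⁻¹ * c ^ ((n : ℤ) - 2 * (r : ℤ) + 1)) c (r : ℕ) /
      qPoch (x * b₁ * b₂⁻¹ * c ^ (-(r : ℤ))) c (n - (r : ℕ)))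

/-- The lower triangular factor `L_R` of Theorem 1.3.3. -/
noncomputable def LRmat (n : ℕ) (c x b₁ b₂ : ℂ) : Matrix (Fin (n + 1)) (Fin (n + 1)) ℂ :=
  fun r s =>
    if (s : ℕ) ≤ (r : ℕ) then
      (-1 : ℂ) ^ ((r : ℕ) - (s : ℕ)) * (b₂ ^ ((r : ℕ) - (s : ℕ)))⁻¹ *
        c ^ (-((((r : ℕ) - (s : ℕ)) * ((r : ℕ) + (s : ℕ) - 1) / 2 : ℕ) : ℤ)) *
        (qPoch c c (n - (s : ℕ)) /
          (qPoch c c ((r : ℕ) - (s : ℕ)) * qPoch c c (n - (r : ℕ)))) *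
        (qPoch (b₂ * c ^ (s : ℕ)) c ((r : ℕ) - (s : ℕ)) /
          qPoch (x * b₁ * b₂⁻¹ * c ^ ((n : ℤ) - 2 * (r : ℤ) + 1)) c ((r : ℕ) - (s : ℕ)))
    else 0

theorem qPoch_zpow (y c : ℂ) (hc : c ≠ 0) (k : ℤ) (m : ℕ) :
    qPoch (y * c ^ k) c m = ∏ i ∈ Finset.range m, (1 - y * c ^ (k + (i : ℤ))) := by
  unfold qPoch
  refine Finset.prod_congr rfl fun i _ => ?_
  rw [zpow_add₀ hc, zpow_natCast]
  ring

theorem qPoch_cc_ne (c : ℂ) (n m : ℕ) (hm : m ≤ n)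
    (hc1 : ∀ m : ℕ, 1 ≤ m → m ≤ n → c ^ m ≠ 1) : qPoch c c m ≠ 0 := by
  unfold qPoch
  refine Finset.prod_ne_zero_iff.mpr fun i hi h => ?_
  have hi := Finset.mem_range.mp hi
  refine hc1 (i + 1) (by omega) (by omega) ?_
  rw [pow_succ]
  exact (sub_eq_zero.mp h).symm

theorem double_prod_eq (n : ℕ) (f : ℤ → ℂ) :
    ∏ r ∈ Finset.range (n + 1), ∏ i ∈ Finset.range r, f ((n : ℤ) - 2 * (r : ℤ) + 1 + (i : ℤ))
    = ∏ r ∈ Finset.range (n + 1), ∏ i ∈ Finset.range (n - r), f (-(r : ℤ) + (i : ℤ)) := by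
  rw [Finset.prod_sigma', Finset.prod_sigma']
  refine Finset.prod_bij' (fun p _ => ⟨p.1 - 1 - p.2, n - p.1⟩)
    (fun p _ => ⟨n - p.2, n - p.2 - 1 - p.1⟩) ?_ ?_ ?_ ?_ ?_
  · rintro ⟨r, i⟩ h
    simp only [Finset.mem_sigma, Finset.mem_range] at h ⊢
    omega
  · rintro ⟨r, i⟩ h
    simp only [Finset.mem_sigma, Finset.mem_range] at h ⊢
    omega
  · rintro ⟨r, i⟩ h
    simp only [Finset.mem_sigma, Finset.mem_range] at h
    simp only [Sigma.mk.injEq, heq_eq_eq]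
    omega
  · rintro ⟨r, i⟩ h
    simp only [Finset.mem_sigma, Finset.mem_range] at h
    simp only [Sigma.mk.injEq, heq_eq_eq]
    omega
  · rintro ⟨r, i⟩ h
    simp only [Finset.mem_sigma, Finset.mem_range] at h
    refine congrArg f ?_
    simp only
    omega

theorem det_URmat (n : ℕ) (c x b₁ b₂ : ℂ)
    (hc1 : ∀ m : ℕ, 1 ≤ m → m ≤ n → c ^ m ≠ 1) : (URmat n c x b₁ b₂).det = 1 := by
  rw [Matrix.det_of_upperTriangular]
  · refine Finset.prod_eq_one fun r _ => ?_
    have h := qPoch_cc_ne c n r (by omega) hc1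
    have h0 : ∀ y : ℂ, qPoch y c 0 = 1 := fun y => by simp [qPoch]
    simp [URmat, h0, h]
  · intro i j hij
    have : ¬ ((i : ℕ) ≤ (j : ℕ)) := by simpa using hij
    simp only [URmat, if_neg this]

theorem det_LRmat (n : ℕ) (c x b₁ b₂ : ℂ)
    (hc1 : ∀ m : ℕ, 1 ≤ m → m ≤ n → c ^ m ≠ 1) : (LRmat n c x b₁ b₂).det = 1 := by
  rw [Matrix.det_of_lowerTriangular]
  · refine Finset.prod_eq_one fun r _ => ?_
    have h := qPoch_cc_ne c n (n - r) (by omega) hc1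
    have h0 : ∀ y : ℂ, qPoch y c 0 = 1 := fun y => by simp [qPoch]
    simp [LRmat, h0, h]
  · intro i j hij
    have : ¬ ((j : ℕ) ≤ (i : ℕ)) := by simpa using hij
    simp only [LRmat, if_neg this]

/-- Corollary 1.3.9 (conjectured by Mimachi): the determinant of the R-matrix
`R_{2,1}(x₂/x₁) = U_R·D_R·L_R` equals
`∏_{r=0}^n b₂^{−(n−r)} c^{−r(n−r)} (xb₁;c)_r/(xb₂⁻¹c^{−(r−1)};c)_r`. -/
theorem det_R_matrix (n : ℕ) (hn : 1 ≤ n) (x b₁ b₂ c : ℂ)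
    (hx : x ≠ 0) (hb₁ : b₁ ≠ 0) (hb₂ : b₂ ≠ 0) (hc : c ≠ 0)
    (hc1 : ∀ m : ℕ, 1 ≤ m → m ≤ n → c ^ m ≠ 1)
    (hx1 : ∀ m : ℤ, |m| ≤ (n : ℤ) → x * c ^ m ≠ 1)
    (hx2 : ∀ m : ℤ, |m| ≤ (n : ℤ) → x * b₂⁻¹ * c ^ m ≠ 1)
    (hx3 : ∀ m : ℤ, |m| ≤ (n : ℤ) → x * b₁ * b₂⁻¹ * c ^ m ≠ 1) :
    Matrix.det
        (URmat n c x b₁ b₂ * Matrix.diagonal (dRdiag n c x b₁ b₂) * LRmat n c x b₁ b₂)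
    = ∏ r ∈ Finset.range (n + 1),
        (b₂ ^ (n - r))⁻¹ * (c ^ (r * (n - r)))⁻¹ *
          qPoch (x * b₁) c r / qPoch (x * b₂⁻¹ * c ^ ((1 : ℤ) - (r : ℤ))) c r := by
  rw [Matrix.det_mul, Matrix.det_mul, det_URmat n c x b₁ b₂ hc1, det_LRmat n c x b₁ b₂ hc1,
    Matrix.det_diagonal, one_mul, mul_one]
  have key : ∏ r ∈ Finset.range (n + 1),
        qPoch (x * b₁ * b₂⁻¹ * c ^ ((n : ℤ) - 2 * (r : ℤ) + 1)) c r
      = ∏ r ∈ Finset.range (n + 1), qPoch (x * b₁ * b₂⁻¹ * c ^ (-(r : ℤ))) c (n - r) := by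
    simp only [qPoch_zpow _ c hc]
    exact double_prod_eq n fun k => 1 - x * b₁ * b₂⁻¹ * c ^ k
  have hne : ∏ r ∈ Finset.range (n + 1),
      qPoch (x * b₁ * b₂⁻¹ * c ^ (-(r : ℤ))) c (n - r) ≠ 0 := by
    simp only [qPoch_zpow _ c hc]
    refine Finset.prod_ne_zero_iff.mpr fun r hr => Finset.prod_ne_zero_iff.mpr fun i hi h => ?_
    have hr := Finset.mem_range.mp hr
    have hi := Finset.mem_range.mp hi
    exact hx3 (-(r : ℤ) + i) (abs_le.mpr ⟨by omega, by omega⟩) (sub_eq_zero.mp h).symm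
  have refl : ∏ r ∈ Finset.range (n + 1), qPoch (x * b₁) c (n - r)
      = ∏ r ∈ Finset.range (n + 1), qPoch (x * b₁) c r := by
    simpa using Finset.prod_range_reflect (fun r => qPoch (x * b₁) c r) (n + 1)
  simp only [dRdiag]
  rw [Fin.prod_univ_eq_prod_range (fun r : ℕ => (b₂ ^ (n - r))⁻¹ * (c ^ (r * (n - r)))⁻¹ *
    (qPoch (x * b₁) c (n - r) / qPoch (x * b₂⁻¹ * c ^ ((1 : ℤ) - (r : ℤ))) c r) *
    (qPoch (x * b₁ * b₂⁻¹ * c ^ ((n : ℤ) - 2 * (r : ℤ) + 1)) c r /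
      qPoch (x * b₁ * b₂⁻¹ * c ^ (-(r : ℤ))) c (n - r))) (n + 1)]
  simp only [Finset.prod_mul_distrib, Finset.prod_div_distrib]
  rw [key, div_self hne, refl, mul_one, mul_div_assoc]
end

section
/- Under the genericity assumptions, write U_R(x,b₁,b₂), D_R(x,b₁,b₂), L_R(x,b₁,b₂) for the explicit matrices, let J be the (n+1)×(n+1) anti-diagonal permutation matrix with entries J_{rs} = δ_{r,n−s}, and for a matrix M depending on (x,b₁,b₂) let τM := M(x^{−1},b₂,b₁). Then L_R(x,b₁,b₂)^{−1} = J·(τU_R)·J, D_R(x,b₁,b₂)^{−1} = J·(τD_R)·J, and U_R(x,b₁,b₂)^{−1} = J·(τL_R)·J. (Remark 1.3.7, expressing the unitarity relation R_{1,2}(x₁/x₂)·R_{2,1}(x₂/x₁) = I at the level of the Gauss factors.) -/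
open Finset

/-- The anti-diagonal permutation matrix `J` with `J_{rs} = δ_{r,n−s}`. -/
noncomputable def Jmat (n : ℕ) : Matrix (Fin (n + 1)) (Fin (n + 1)) ℂ :=
  fun r s => if (r : ℕ) + (s : ℕ) = n then 1 else 0

section Helpers

lemma qPoch_succ (x c : ℂ) (m : ℕ) : qPoch x c (m + 1) = qPoch x c m * (1 - c ^ m * x) := by
  simp [qPoch, Finset.prod_range_succ]

lemma qPoch_succ' (x c : ℂ) (m : ℕ) : qPoch x c (m + 1) = (1 - x) * qPoch (x * c) c m := by
  simp only [qPoch, Finset.prod_range_succ']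
  rw [mul_comm]
  congr 1
  · simp
  · apply Finset.prod_congr rfl
    intro i _
    ring

lemma qPoch_zero (x c : ℂ) : qPoch x c 0 = 1 := by simp [qPoch]

lemma qPoch_ne_zero {x c : ℂ} {m : ℕ} (h : ∀ i < m, c ^ i * x ≠ 1) : qPoch x c m ≠ 0 := by
  unfold qPoch
  rw [Finset.prod_ne_zero_iff]
  intro i hi
  rw [sub_ne_zero]
  exact (h i (Finset.mem_range.mp hi)).symm

/-- reversal of the q-Pochhammer symbol -/
lemma qPoch_rev {w v c : ℂ} (hw : w ≠ 0) (hc : c ≠ 0) (m : ℕ) (hv : v = w⁻¹ * c ^ ((1 : ℤ) - m)) :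
    qPoch w c m = (-w) ^ m * (∏ i ∈ Finset.range m, c ^ i) * qPoch v c m := by
  unfold qPoch
  rw [← Finset.prod_range_reflect (fun i => 1 - c ^ i * v), ← Finset.card_range m,
    ← Finset.prod_const, Finset.card_range, ← Finset.prod_mul_distrib, ← Finset.prod_mul_distrib]
  apply Finset.prod_congr rfl
  intro i hi
  have hi' := Finset.mem_range.mp hi
  obtain ⟨p, rfl⟩ : ∃ p, m = i + p + 1 := ⟨m - i - 1, by omega⟩
  have e : i + p + 1 - 1 - i = p := by omega
  rw [e, hv]
  have e2 : (1 : ℤ) - ((i + p + 1 : ℕ) : ℤ) = -((i : ℤ) + (p : ℤ)) := by push_cast; ring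
  rw [e2, zpow_neg, zpow_add₀ hc, zpow_natCast, zpow_natCast]
  field_simp
  ring

lemma tri_step (r k : ℕ) (h : k + 1 ≤ r) :
    (r - k) * (r + k - 1) / 2 = (r - (k + 1)) * (r + (k + 1) - 1) / 2 + k := by
  obtain ⟨p, rfl⟩ : ∃ p, r = k + 1 + p := ⟨r - (k + 1), by omega⟩
  have e1 : k + 1 + p - k = p + 1 := by omega
  have e2 : k + 1 + p + k - 1 = 2 * k + p := by omega
  have e3 : k + 1 + p - (k + 1) = p := by omega
  have e4 : k + 1 + p + (k + 1) - 1 = 2 * k + p + 1 := by omega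
  rw [e1, e2, e3, e4]
  have : (p + 1) * (2 * k + p) = p * (2 * k + p + 1) + k * 2 := by ring
  rw [this, Nat.add_mul_div_right _ _ (by norm_num)]

noncomputable def uN (n : ℕ) (c x b₁ b₂ : ℂ) (r s : ℕ) : ℂ :=
    if r ≤ s then
      (-1 : ℂ) ^ (s - r) * (x * b₂⁻¹) ^ (s - r) *
        c ^ (-(((s - r) * (s + r - 1) / 2 : ℕ) : ℤ)) *
        (qPoch c c s / (qPoch c c (s - r) * qPoch c c r)) *
        (qPoch (b₁ * c ^ (n - s)) c (s - r) /
          qPoch (x * b₁ * b₂⁻¹ * c ^ ((n : ℤ) - 2 * (s : ℤ) + 1)) c (s - r))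
    else 0

noncomputable def lN (n : ℕ) (c x b₁ b₂ : ℂ) (r s : ℕ) : ℂ :=
    if s ≤ r then
      (-1 : ℂ) ^ (r - s) * (b₂ ^ (r - s))⁻¹ *
        c ^ (-(((r - s) * (r + s - 1) / 2 : ℕ) : ℤ)) *
        (qPoch c c (n - s) / (qPoch c c (r - s) * qPoch c c (n - r))) *
        (qPoch (b₂ * c ^ s) c (r - s) /
          qPoch (x * b₁ * b₂⁻¹ * c ^ ((n : ℤ) - 2 * (r : ℤ) + 1)) c (r - s))
    else 0

lemma qcc_ne {n : ℕ} {c : ℂ} (hc1 : ∀ m : ℕ, 1 ≤ m → m ≤ n → c ^ m ≠ 1) (m : ℕ) (hm : m ≤ n) :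
    qPoch c c m ≠ 0 := by
  apply qPoch_ne_zero
  intro i hi
  rw [← pow_succ]
  exact hc1 _ (by omega) (by omega)

lemma uN_step {n : ℕ} {c x b₁ b₂ : ℂ} (hc : c ≠ 0)
    (hc1 : ∀ m : ℕ, 1 ≤ m → m ≤ n → c ^ m ≠ 1)
    (r s : ℕ) (hrs : r + 1 ≤ s) (hs : s ≤ n) :
    uN n c x b₁ b₂ r s = uN n c x b₁ b₂ (r + 1) s * (-(x * b₂⁻¹)) * (c ^ r)⁻¹ *
      ((1 - c ^ (r + 1)) / (1 - c ^ (s - r))) *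
      ((1 - b₁ * c ^ (n - (r + 1))) / (1 - x * b₁ * b₂⁻¹ * c ^ ((n : ℤ) - s - r))) := by
  have h1 := qcc_ne hc1 r (by omega)
  have h2 := hc1 (r + 1) (by omega) (by omega)
  have h2' : 1 - c ^ (r + 1) ≠ 0 := sub_ne_zero.mpr h2.symm
  unfold uN
  rw [if_pos (by omega), if_pos hrs, tri_step s r hrs]
  obtain ⟨p, rfl⟩ : ∃ p, s = r + 1 + p := ⟨s - (r + 1), by omega⟩
  obtain ⟨q, rfl⟩ : ∃ q, n = r + 1 + p + q := ⟨n - (r + 1 + p), by omega⟩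
  have e1 : r + 1 + p - r = p + 1 := by omega
  have e3 : r + 1 + p - (r + 1) = p := by omega
  have e4 : r + 1 + p + q - (r + 1 + p) = q := by omega
  have e5 : r + 1 + p + q - (r + 1) = p + q := by omega
  rw [e1, e3, e4, e5]
  generalize p * (r + 1 + p + (r + 1) - 1) / 2 = T
  rw [qPoch_succ _ _ p, qPoch_succ _ _ p, qPoch_succ _ _ p, qPoch_succ _ _ r]
  have e6 : c ^ p * (x * b₁ * b₂⁻¹ * c ^ (((r + 1 + p + q : ℕ) : ℤ) - 2 * ((r + 1 + p : ℕ) : ℤ) + 1))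
      = x * b₁ * b₂⁻¹ * c ^ (((r + 1 + p + q : ℕ) : ℤ) - ((r + 1 + p : ℕ) : ℤ) - (r : ℤ)) := by
    rw [← zpow_natCast c p, mul_left_comm, ← zpow_add₀ hc]
    congr 2
    push_cast
    ring
  rw [e6]
  have e7 : c ^ (-((T + r : ℕ) : ℤ)) = c ^ (-(T : ℤ)) * (c ^ r)⁻¹ := by
    rw [← zpow_natCast c r, ← zpow_neg, ← zpow_add₀ hc]; congr 1; push_cast; ring
  rw [e7]
  have e8 : c ^ p * (b₁ * c ^ q) = b₁ * c ^ (p + q) := by ring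
  rw [e8, ← pow_succ, ← pow_succ]
  generalize qPoch (b₁ * c ^ q) c p = A
  generalize qPoch (x * b₁ * b₂⁻¹ * _) c p = B
  generalize 1 - x * b₁ * b₂⁻¹ * _ = C
  generalize 1 - b₁ * _ = D
  generalize 1 - c ^ (r + 1) = E at *
  generalize 1 - c ^ (p + 1) = F
  have e9 : E * (qPoch c c r * E)⁻¹ = (qPoch c c r)⁻¹ := by field_simp
  simp only [div_eq_mul_inv, mul_inv] at *
  have : (qPoch c c r)⁻¹ = (qPoch c c r)⁻¹ * (E * E⁻¹) := by rw [mul_inv_cancel₀ h2', mul_one]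
  nth_rewrite 1 [this]
  ring

lemma lN_step {n : ℕ} {c x b₁ b₂ : ℂ} (hc : c ≠ 0)
    (r k : ℕ) (hrs : k + 1 ≤ r) (hs : r ≤ n) :
    lN n c x b₁ b₂ r k = lN n c x b₁ b₂ r (k + 1) * (-(b₂⁻¹)) * (c ^ k)⁻¹ *
      ((1 - c ^ (n - k)) / (1 - c ^ (r - k))) *
      ((1 - b₂ * c ^ k) / (1 - x * b₁ * b₂⁻¹ * c ^ ((n : ℤ) - r - k))) := by
  unfold lN
  rw [if_pos (by omega), if_pos hrs, tri_step r k hrs]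
  obtain ⟨p, rfl⟩ : ∃ p, r = k + 1 + p := ⟨r - (k + 1), by omega⟩
  obtain ⟨q, rfl⟩ : ∃ q, n = k + 1 + p + q := ⟨n - (k + 1 + p), by omega⟩
  have e1 : k + 1 + p - k = p + 1 := by omega
  have e3 : k + 1 + p - (k + 1) = p := by omega
  have e4 : k + 1 + p + q - (k + 1 + p) = q := by omega
  have e5 : k + 1 + p + q - k = p + q + 1 := by omega
  have e5' : k + 1 + p + q - (k + 1) = p + q := by omega
  rw [e1, e3, e4, e5, e5']
  generalize p * (k + 1 + p + (k + 1) - 1) / 2 = T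
  rw [qPoch_succ' (b₂ * c ^ k) _ p, qPoch_succ (x * b₁ * b₂⁻¹ * _) _ p, qPoch_succ c _ p,
    qPoch_succ c _ (p + q)]
  have e6 : c ^ p * (x * b₁ * b₂⁻¹ * c ^ (((k + 1 + p + q : ℕ) : ℤ) - 2 * ((k + 1 + p : ℕ) : ℤ) + 1))
      = x * b₁ * b₂⁻¹ * c ^ (((k + 1 + p + q : ℕ) : ℤ) - ((k + 1 + p : ℕ) : ℤ) - (k : ℤ)) := by
    rw [← zpow_natCast c p, mul_left_comm, ← zpow_add₀ hc]
    congr 2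
    push_cast
    ring
  rw [e6]
  have e7 : c ^ (-((T + k : ℕ) : ℤ)) = c ^ (-(T : ℤ)) * (c ^ k)⁻¹ := by
    rw [← zpow_natCast c k, ← zpow_neg, ← zpow_add₀ hc]; congr 1; push_cast; ring
  rw [e7]
  have e8 : b₂ * c ^ k * c = b₂ * c ^ (k + 1) := by ring
  rw [e8, ← pow_succ, ← pow_succ]
  generalize qPoch (b₂ * c ^ (k + 1)) c p = A
  generalize qPoch (x * b₁ * b₂⁻¹ * _) c p = B
  generalize 1 - x * b₁ * b₂⁻¹ * _ = C
  generalize 1 - b₂ * _ = D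
  generalize 1 - c ^ (p + q + 1) = E at *
  generalize 1 - c ^ (p + 1) = F
  simp only [div_eq_mul_inv, mul_inv] at *
  ring

lemma telescoping (c a b : ℂ) (t : ℕ → ℂ) (N : ℕ)
    (h : ∀ j < N, t (j + 1) * ((1 - c ^ (j + 1)) * (1 - a * b * c ^ (j + 1)))
      = t j * (c * (1 - a * c ^ j) * (1 - b * c ^ j))) (J : ℕ) (hJ : J ≤ N) :
    c ^ J * ((1 - a) * (1 - b)) * ∑ j ∈ Finset.range (J + 1), t j
      = (1 - a * c ^ J) * (1 - b * c ^ J) * t J := by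
  induction J with
  | zero => simp
  | succ J ih =>
    rw [Finset.sum_range_succ]
    have h1 := ih (by omega)
    have h2 := h J (by omega)
    linear_combination c * h1 - h2

/-- main orthogonality relation -/
lemma orth {n : ℕ} {c x b₁ b₂ : ℂ} (hx : x ≠ 0) (hb₁ : b₁ ≠ 0) (hb₂ : b₂ ≠ 0) (hc : c ≠ 0)
    (hc1 : ∀ m : ℕ, 1 ≤ m → m ≤ n → c ^ m ≠ 1)
    (hx3 : ∀ m : ℤ, |m| ≤ (n : ℤ) → x * b₁ * b₂⁻¹ * c ^ m ≠ 1)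
    (r s : ℕ) (hsr : s < r) (hr : r ≤ n) :
    ∑ j ∈ Finset.range (r - s + 1),
      lN n c x b₁ b₂ r (s + j) * uN n c x⁻¹ b₂ b₁ (n - (s + j)) (n - s) = 0 := by
  have key := telescoping c (c ^ (-((r : ℤ) - s))) ((x * b₁ * b₂⁻¹)⁻¹ * c ^ ((r : ℤ) + s - n))
    (fun j => lN n c x b₁ b₂ r (s + j) * uN n c x⁻¹ b₂ b₁ (n - (s + j)) (n - s)) (r - s) ?_
    (r - s) le_rfl
  · have hy : x * b₁ * b₂⁻¹ ≠ 0 := by positivity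
    have e : c ^ (-((r : ℤ) - s)) * c ^ (r - s) = 1 := by
      rw [← zpow_natCast c (r - s), ← zpow_add₀ hc, Nat.cast_sub hsr.le]
      simp
    rw [e] at key
    simp only [sub_self, zero_mul] at key
    have n1 : 1 - c ^ (-((r : ℤ) - s)) ≠ 0 := by
      intro h0
      have h1 : c ^ (-((r : ℤ) - s)) = 1 := (sub_eq_zero.mp h0).symm
      rw [h1, one_mul] at e
      exact hc1 _ (by omega) (by omega) e
    have n2 : 1 - (x * b₁ * b₂⁻¹)⁻¹ * c ^ ((r : ℤ) + s - n) ≠ 0 := by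
      intro h0
      apply hx3 (-((r : ℤ) + s - n)) (by rw [abs_le]; constructor <;> omega)
      rw [zpow_neg, ← inv_inv (x * b₁ * b₂⁻¹), ← mul_inv, (sub_eq_zero.mp h0).symm, inv_one]
    exact (mul_eq_zero.mp key).resolve_left
      (mul_ne_zero (pow_ne_zero _ hc) (mul_ne_zero n1 n2))
  · intro j hj
    have hL := lN_step (n := n) (x := x) (b₁ := b₁) (b₂ := b₂) hc r (s + j) (by omega) hr
    have hU := uN_step (n := n) (x := x⁻¹) (b₁ := b₂) (b₂ := b₁) hc hc1 (n - (s + j + 1)) (n - s)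
      (by omega) (by omega)
    have f1 : n - (s + j + 1) + 1 = n - (s + j) := by omega
    have f2 : n - s - (n - (s + j + 1)) = j + 1 := by omega
    have f3 : n - (n - (s + j)) = s + j := by omega
    rw [f1, f2, f3] at hU
    have hy3 := hx3 ((n : ℤ) - r - (s + j : ℕ)) (by rw [abs_le]; constructor <;> omega)
    have hy4 := hx3 ((n : ℤ) - s - (s + j : ℕ) - 1) (by rw [abs_le]; constructor <;> omega)
    have hc2 := hc1 (r - (s + j)) (by omega) (by omega)
    have hc3 := hc1 (j + 1) (by omega) (by omega)
    simp only [← add_assoc]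
    rw [hL, hU]
    generalize lN n c x b₁ b₂ r (s + j + 1) = A
    generalize uN n c x⁻¹ b₂ b₁ (n - (s + j)) (n - s) = B
    have g1 : c ^ (-((r : ℤ) - s)) * c ^ j = (c ^ (r - (s + j)))⁻¹ := by
      rw [← zpow_natCast c j, ← zpow_natCast c (r - (s + j)), ← zpow_add₀ hc, ← zpow_neg,
        Nat.cast_sub (by omega)]
      congr 1; push_cast; ring
    have g2 : (x * b₁ * b₂⁻¹)⁻¹ * c ^ ((r : ℤ) + s - n) * c ^ j
        = (x * b₁ * b₂⁻¹ * c ^ ((n : ℤ) - r - (s + j : ℕ)))⁻¹ := by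
      rw [mul_inv _ (c ^ _), ← zpow_natCast c j, ← zpow_neg, mul_assoc, ← zpow_add₀ hc]
      congr 2; push_cast; ring
    have g3 : c ^ (-((r : ℤ) - s)) * ((x * b₁ * b₂⁻¹)⁻¹ * c ^ ((r : ℤ) + s - n)) * c ^ (j + 1)
        = x⁻¹ * b₂ * b₁⁻¹ * c ^ ((n : ℤ) - (n - s : ℕ) - (n - (s + j + 1) : ℕ)) := by
      rw [← zpow_natCast c (j + 1), mul_left_comm, mul_assoc, ← zpow_add₀ hc, ← zpow_add₀ hc,
        Nat.cast_sub (by omega), Nat.cast_sub (by omega), mul_inv, mul_inv, inv_inv]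
      have : -((r : ℤ) - s) + (r + s - n) + ((j + 1 : ℕ) : ℤ)
        = (n : ℤ) - (n - s) - (n - ((s + j + 1 : ℕ) : ℤ)) := by push_cast; ring
      rw [this]; ring
    have g4 : x⁻¹ * b₂ * b₁⁻¹ * c ^ ((n : ℤ) - (n - s : ℕ) - (n - (s + j + 1) : ℕ)) ≠ 1 := by
      intro h0
      apply hy4
      rw [← inv_eq_one] at h0
      rw [← h0, mul_inv, ← zpow_neg, mul_inv, mul_inv, inv_inv, inv_inv]
      have : -((n : ℤ) - (n - s : ℕ) - (n - (s + j + 1) : ℕ)) = (n : ℤ) - s - (s + j : ℕ) - 1 := by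
        omega
      rw [this]; ring
    have g5 : x⁻¹ * b₁⁻¹ * (c ^ (n - (s + j + 1)))⁻¹ = b₂⁻¹ * (c ^ (s + j))⁻¹ * c *
        (c ^ (r - (s + j)))⁻¹ * (x * b₁ * b₂⁻¹ * c ^ ((n : ℤ) - r - (s + j : ℕ)))⁻¹ := by
      have : (n : ℤ) - r - (s + j : ℕ) = (n - (s + j + 1) : ℕ) + 1 - (r - (s + j) : ℕ)
        - (s + j : ℕ) := by omega
      rw [this, zpow_sub₀ hc, zpow_sub₀ hc, zpow_add₀ hc]
      simp only [zpow_natCast, zpow_one]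
      field_simp
    have hz : x * b₁ * b₂⁻¹ * c ^ ((n : ℤ) - r - (s + j : ℕ)) ≠ 0 := by positivity
    have hw : c ^ (r - (s + j)) ≠ 0 := by positivity
    rw [g1, g2, g3]
    generalize x * b₁ * b₂⁻¹ * c ^ ((n : ℤ) - r - (s + j : ℕ)) = Z at *
    generalize x⁻¹ * b₂ * b₁⁻¹ * c ^ ((n : ℤ) - (n - s : ℕ) - (n - (s + j + 1) : ℕ)) = Y at *
    generalize c ^ (r - (s + j)) = W at *
    generalize c ^ (j + 1) = V at *
    generalize 1 - c ^ (n - (s + j)) = P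
    generalize 1 - b₂ * c ^ (s + j) = Q
    have k1 : 1 - V ≠ 0 := sub_ne_zero.mpr hc3.symm
    have k2 : 1 - Y ≠ 0 := sub_ne_zero.mpr g4.symm
    have k3 : 1 - W ≠ 0 := sub_ne_zero.mpr hc2.symm
    have k4 : 1 - Z ≠ 0 := sub_ne_zero.mpr hy3.symm
    have m1 : 1 - W⁻¹ = -(1 - W) * W⁻¹ := by field_simp; ring
    have m2 : 1 - Z⁻¹ = -(1 - Z) * Z⁻¹ := by field_simp; ring
    rw [m1, m2]
    generalize 1 - V = V' at *
    generalize 1 - Y = Y' at *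
    generalize 1 - W = W' at *
    generalize 1 - Z = Z' at *
    calc _ = -(A * B * P * Q) * (x⁻¹ * b₁⁻¹ * (c ^ (n - (s + j + 1)))⁻¹) := by
            field_simp
      _ = _ := by
            rw [g5]
            field_simp

lemma lN_diag {n : ℕ} {c x b₁ b₂ : ℂ} (hc1 : ∀ m : ℕ, 1 ≤ m → m ≤ n → c ^ m ≠ 1)
    (r : ℕ) : lN n c x b₁ b₂ r r = 1 := by
  have := qcc_ne hc1 (n - r) (by omega)
  simp [lN, qPoch_zero, this]

lemma uN_diag {n : ℕ} {c x b₁ b₂ : ℂ} (hc1 : ∀ m : ℕ, 1 ≤ m → m ≤ n → c ^ m ≠ 1)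
    (r : ℕ) (hr : r ≤ n) : uN n c x b₁ b₂ r r = 1 := by
  have := qcc_ne hc1 r hr
  simp [uN, qPoch_zero, this]

lemma J_conj (n : ℕ) (M : Matrix (Fin (n + 1)) (Fin (n + 1)) ℂ) :
    Jmat n * M * Jmat n = M.submatrix Fin.rev Fin.rev := by
  have hJ : ∀ r s : Fin (n + 1), Jmat n r s = if s = Fin.rev r then 1 else 0 := by
    intro r s
    unfold Jmat
    congr 1
    rw [Fin.ext_iff, Fin.val_rev]
    apply propext
    omega
  have hJ' : ∀ r s : Fin (n + 1), Jmat n r s = if r = Fin.rev s then 1 else 0 := by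
    intro r s
    rw [hJ]
    congr 1
    rw [Fin.ext_iff, Fin.ext_iff, Fin.val_rev, Fin.val_rev]
    apply propext
    omega
  ext r s
  rw [Matrix.mul_apply, Matrix.submatrix_apply]
  rw [Finset.sum_eq_single (Fin.rev s), hJ', if_pos rfl, mul_one, Matrix.mul_apply,
    Finset.sum_eq_single (Fin.rev r), hJ, if_pos rfl, one_mul]
  · intro k _ hk
    rw [hJ, if_neg hk, zero_mul]
  · simp
  · intro k _ hk
    rw [hJ', if_neg hk, mul_zero]
  · simp

lemma LU_one {n : ℕ} {c x b₁ b₂ : ℂ} (hx : x ≠ 0) (hb₁ : b₁ ≠ 0) (hb₂ : b₂ ≠ 0) (hc : c ≠ 0)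
    (hc1 : ∀ m : ℕ, 1 ≤ m → m ≤ n → c ^ m ≠ 1)
    (hx3 : ∀ m : ℤ, |m| ≤ (n : ℤ) → x * b₁ * b₂⁻¹ * c ^ m ≠ 1) :
    LRmat n c x b₁ b₂ * (URmat n c x⁻¹ b₂ b₁).submatrix Fin.rev Fin.rev = 1 := by
  ext r s
  rw [Matrix.mul_apply]
  have h1 : ∀ k : Fin (n + 1), LRmat n c x b₁ b₂ r k *
      (URmat n c x⁻¹ b₂ b₁).submatrix Fin.rev Fin.rev k s
      = (fun k : ℕ => lN n c x b₁ b₂ r k * uN n c x⁻¹ b₂ b₁ (n - k) (n - s)) k := by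
    intro k
    have hk : (Fin.rev k : ℕ) = n - k := by rw [Fin.val_rev]; omega
    have hs : (Fin.rev s : ℕ) = n - s := by rw [Fin.val_rev]; omega
    simp only [Matrix.submatrix_apply]
    rw [← hk, ← hs]
    rfl
  rw [Finset.sum_congr rfl (fun k _ => h1 k)]
  refine (Fin.sum_univ_eq_sum_range
    (fun k : ℕ => lN n c x b₁ b₂ r k * uN n c x⁻¹ b₂ b₁ (n - k) (n - s)) (n + 1)).trans ?_
  have hr := r.isLt
  have hs := s.isLt
  have hl0 : ∀ k, (r : ℕ) < k → lN n c x b₁ b₂ r k = 0 := by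
    intro k hk
    simp [lN, hk]
  have hu0 : ∀ k, k < (s : ℕ) → uN n c x⁻¹ b₂ b₁ (n - k) (n - s) = 0 := by
    intro k hk
    rw [uN, if_neg (by omega)]
  rcases lt_trichotomy (r : ℕ) s with h | h | h
  · rw [Matrix.one_apply_ne (by intro h0; rw [h0] at h; omega)]
    apply Finset.sum_eq_zero
    intro k _
    rcases lt_or_ge k (s : ℕ) with hk | hk
    · rw [hu0 k hk, mul_zero]
    · rw [hl0 k (by omega), zero_mul]
  · have : r = s := Fin.ext h
    subst this
    rw [Matrix.one_apply_eq, Finset.sum_eq_single (r : ℕ)]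
    · rw [lN_diag hc1, uN_diag hc1 _ (by omega), mul_one]
    · intro k _ hk
      rcases lt_or_ge k (r : ℕ) with hk' | hk'
      · rw [hu0 k hk', mul_zero]
      · rw [hl0 k (by omega), zero_mul]
    · intro h0
      exact absurd (Finset.mem_range.mpr hr) h0
  · rw [Matrix.one_apply_ne (by intro h0; rw [h0] at h; omega)]
    rw [← orth hx hb₁ hb₂ hc hc1 hx3 r s h (by omega)]
    have e := Finset.sum_Ico_eq_sum_range
      (fun k : ℕ => lN n c x b₁ b₂ r k * uN n c x⁻¹ b₂ b₁ (n - k) (n - s)) s (r + 1)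
    have e' : (r : ℕ) + 1 - s = r - s + 1 := by omega
    rw [e'] at e
    rw [← e]
    symm
    apply Finset.sum_subset
    · intro k hk
      simp only [Finset.mem_Ico, Finset.mem_range] at *
      omega
    · intro k _ hk
      simp only [Finset.mem_Ico, not_and_or, not_le, not_lt] at hk
      rcases hk with hk | hk
      · rw [hu0 k hk, mul_zero]
      · rw [hl0 k (by omega), zero_mul]

lemma d_one {n : ℕ} {c x b₁ b₂ : ℂ} (hx : x ≠ 0) (hb₁ : b₁ ≠ 0) (hb₂ : b₂ ≠ 0) (hc : c ≠ 0)
    (hxb1 : ∀ m : ℤ, |m| ≤ (n : ℤ) → x * b₁ * c ^ m ≠ 1)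
    (hx2 : ∀ m : ℤ, |m| ≤ (n : ℤ) → x * b₂⁻¹ * c ^ m ≠ 1)
    (hx3 : ∀ m : ℤ, |m| ≤ (n : ℤ) → x * b₁ * b₂⁻¹ * c ^ m ≠ 1) (r₀ : Fin (n + 1)) :
    dRdiag n c x b₁ b₂ r₀ * dRdiag n c x⁻¹ b₂ b₁ (Fin.rev r₀) = 1 := by
  have hr := r₀.isLt
  have hrev : (Fin.rev r₀ : ℕ) = n - r₀ := by rw [Fin.val_rev]; omega
  unfold dRdiag
  rw [hrev]
  generalize (r₀ : ℕ) = r at hr hrev ⊢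
  clear hrev
  obtain ⟨m, rfl⟩ : ∃ m, n = r + m := ⟨n - r, by omega⟩
  have e1 : r + m - r = m := by omega
  have e2 : r + m - m = r := by omega
  rw [e1, e2]
  have hy : x * b₁ * b₂⁻¹ ≠ 0 := by positivity
  have q1 := qPoch_rev (w := x * b₁) (v := x⁻¹ * b₁⁻¹ * c ^ ((1 : ℤ) - m))
    (by positivity) hc m (by rw [mul_inv])
  have q2 := qPoch_rev (w := x⁻¹ * b₂) (v := x * b₂⁻¹ * c ^ ((1 : ℤ) - r))
    (by positivity) hc r (by rw [mul_inv, inv_inv])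
  have q3 := qPoch_rev (w := x⁻¹ * b₂ * b₁⁻¹ * c ^ (-(m : ℤ)))
    (v := x * b₁ * b₂⁻¹ * c ^ (((r + m : ℕ) : ℤ) - 2 * r + 1)) (by positivity) hc r (by
      have : ((r + m : ℕ) : ℤ) - 2 * r + 1 = m + (1 - r) := by push_cast; ring
      rw [this, zpow_add₀ hc, zpow_neg]
      field_simp)
  have q4 := qPoch_rev (w := x * b₁ * b₂⁻¹ * c ^ (-(r : ℤ)))
    (v := x⁻¹ * b₂ * b₁⁻¹ * c ^ (((r + m : ℕ) : ℤ) - 2 * m + 1)) (by positivity) hc m (by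
      have : ((r + m : ℕ) : ℤ) - 2 * m + 1 = r + (1 - m) := by push_cast; ring
      rw [this, zpow_add₀ hc, zpow_neg]
      field_simp)
  have z1 : qPoch (x * b₁) c m ≠ 0 := by
    apply qPoch_ne_zero
    intro i hi
    have := hxb1 i (by rw [abs_le]; constructor <;> omega)
    rwa [zpow_natCast, mul_comm] at this
  have z2 : qPoch (x * b₂⁻¹ * c ^ ((1 : ℤ) - r)) c r ≠ 0 := by
    apply qPoch_ne_zero
    intro i hi
    have := hx2 (i + (1 - r)) (by rw [abs_le]; constructor <;> omega)
    rwa [zpow_add₀ hc, zpow_natCast, mul_left_comm] at this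
  have z3 : qPoch (x * b₁ * b₂⁻¹ * c ^ (((r + m : ℕ) : ℤ) - 2 * r + 1)) c r ≠ 0 := by
    apply qPoch_ne_zero
    intro i hi
    have := hx3 (i + (((r + m : ℕ) : ℤ) - 2 * r + 1)) (by rw [abs_le]; constructor <;> omega)
    rwa [zpow_add₀ hc, zpow_natCast, mul_left_comm] at this
  have z4 : qPoch (x * b₁ * b₂⁻¹ * c ^ (-(r : ℤ))) c m ≠ 0 := by
    apply qPoch_ne_zero
    intro i hi
    have := hx3 (i + (-(r : ℤ))) (by rw [abs_le]; constructor <;> omega)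
    rwa [zpow_add₀ hc, zpow_natCast, mul_left_comm] at this
  rw [q1] at z1
  rw [q4] at z4
  rw [q1, q2, q3, q4]
  have p1 : ∏ i ∈ Finset.range m, c ^ i ≠ 0 := Finset.prod_ne_zero_iff.mpr fun i _ => pow_ne_zero _ hc
  have p2 : ∏ i ∈ Finset.range r, c ^ i ≠ 0 := Finset.prod_ne_zero_iff.mpr fun i _ => pow_ne_zero _ hc
  generalize ∏ i ∈ Finset.range m, c ^ i = C1 at *
  generalize ∏ i ∈ Finset.range r, c ^ i = C2 at *
  have y1 := right_ne_zero_of_mul z1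
  have y4 := right_ne_zero_of_mul z4
  clear q1 q2 q3 q4 z1 z4
  generalize qPoch (x⁻¹ * b₁⁻¹ * c ^ ((1 : ℤ) - m)) c m = A1 at *
  generalize qPoch (x * b₂⁻¹ * c ^ ((1 : ℤ) - r)) c r = A2 at *
  generalize qPoch (x * b₁ * b₂⁻¹ * c ^ (((r + m : ℕ) : ℤ) - 2 * r + 1)) c r = A3 at *
  generalize qPoch (x⁻¹ * b₂ * b₁⁻¹ * c ^ (((r + m : ℕ) : ℤ) - 2 * m + 1)) c m = A4 at *
  simp only [zpow_neg, zpow_natCast]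
  simp only [neg_pow (_ * _), mul_pow, inv_pow, ← pow_mul]
  rw [mul_comm m r]
  field_simp

end Helpers

/-- Remark 1.3.7: with `τM := M(x⁻¹,b₂,b₁)`, the Gauss factors of the R-matrix satisfy
`L_R⁻¹ = J·(τU_R)·J`, `D_R⁻¹ = J·(τD_R)·J` and `U_R⁻¹ = J·(τL_R)·J`
(the unitarity `R_{1,2}(x₁/x₂)·R_{2,1}(x₂/x₁) = I` at the level of Gauss factors). -/
theorem remark1_3_7 (n : ℕ) (hn : 1 ≤ n) (x b₁ b₂ c : ℂ)
    (hx : x ≠ 0) (hb₁ : b₁ ≠ 0) (hb₂ : b₂ ≠ 0) (hc : c ≠ 0)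
    (hc1 : ∀ m : ℕ, 1 ≤ m → m ≤ n → c ^ m ≠ 1)
    (hx1 : ∀ m : ℤ, |m| ≤ (n : ℤ) → x * c ^ m ≠ 1)
    (hxb1 : ∀ m : ℤ, |m| ≤ (n : ℤ) → x * b₁ * c ^ m ≠ 1)
    (hx2 : ∀ m : ℤ, |m| ≤ (n : ℤ) → x * b₂⁻¹ * c ^ m ≠ 1)
    (hx3 : ∀ m : ℤ, |m| ≤ (n : ℤ) → x * b₁ * b₂⁻¹ * c ^ m ≠ 1) :
    (LRmat n c x b₁ b₂)⁻¹ = Jmat n * URmat n c x⁻¹ b₂ b₁ * Jmat n ∧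
    (Matrix.diagonal (dRdiag n c x b₁ b₂))⁻¹
      = Jmat n * Matrix.diagonal (dRdiag n c x⁻¹ b₂ b₁) * Jmat n ∧
    (URmat n c x b₁ b₂)⁻¹ = Jmat n * LRmat n c x⁻¹ b₂ b₁ * Jmat n := by
  have A := LU_one hx hb₁ hb₂ hc hc1 hx3
  have hx3' : ∀ m : ℤ, |m| ≤ (n : ℤ) → x⁻¹ * b₂ * b₁⁻¹ * c ^ m ≠ 1 := by
    intro m hm h0
    apply hx3 (-m) (by rwa [abs_neg])
    rw [← inv_eq_one] at h0
    rw [← h0, mul_inv, ← zpow_neg, mul_inv, mul_inv, inv_inv, inv_inv]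
    ring
  have B := LU_one (inv_ne_zero hx) hb₂ hb₁ hc hc1 hx3'
  rw [inv_inv] at B
  have hinv : ∀ M : Matrix (Fin (n + 1)) (Fin (n + 1)) ℂ,
      (M.submatrix Fin.rev Fin.rev).submatrix Fin.rev Fin.rev = M := by
    intro M; ext i j; simp
  refine ⟨?_, ?_, ?_⟩
  · rw [J_conj]
    exact Matrix.inv_eq_right_inv A
  · rw [J_conj]
    apply Matrix.inv_eq_right_inv
    have : (Matrix.diagonal (dRdiag n c x⁻¹ b₂ b₁)).submatrix Fin.rev Fin.rev
        = Matrix.diagonal (dRdiag n c x⁻¹ b₂ b₁ ∘ Fin.rev) :=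
      Matrix.submatrix_diagonal _ _ Fin.rev_injective
    rw [this, Matrix.diagonal_mul_diagonal, ← Matrix.diagonal_one]
    congr 1
    funext r
    exact d_one hx hb₁ hb₂ hc hxb1 hx2 hx3 r
  · rw [J_conj]
    apply Matrix.inv_eq_left_inv
    have h := congrArg (fun M => M.submatrix Fin.rev Fin.rev) B
    have e := Matrix.submatrix_mul_equiv (LRmat n c x⁻¹ b₂ b₁)
      ((URmat n c x b₁ b₂).submatrix Fin.rev Fin.rev) Fin.rev Fin.revPerm Fin.rev
    have e' : (1 : Matrix (Fin (n + 1)) (Fin (n + 1)) ℂ).submatrix Fin.rev Fin.rev = 1 :=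
      Matrix.submatrix_one _ Fin.rev_injective
    simp only [e'] at h
    rw [← h, ← e]
    congr 1
    exact (hinv _).symm
end
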